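/- arXiv:2311.18193 — 2 statements merged into one kernel-verified Lean document; each statement's English description precedes it below -/
import Mathlib

section
/- Let μ0, μ1 ∈ ℝ, p0 ∈ (0,1), α ∈ (0,1), and let (ε_t)_{t≥1} be a sequence in [0,1) such that α·p0/(1−ε_t) ≤ 1 for every t. Let (u_t)_{t≥0} be a real sequence satisfying the recurrence u_t = (1 − α·p0/(1−ε_t))·u_{t−1} + (α·p0/(1−ε_t))·((1−ε_t)·μ0 + ε_t·μ1) for all t ≥ 1, and define d_t = |u_t − μ1|. Then for every t ≥ 1, d_t − d_{t−1} ≤ α·p0·(|μ0 − μ1| − d_{t−1}/(1−ε_t)). -/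
theorem stmt_2 (μ0 μ1 p0 α : ℝ) (hp0 : 0 < p0) (hp0' : p0 < 1)
    (hα : 0 < α) (hα' : α < 1)
    (ε : ℕ → ℝ) (hε0 : ∀ t, 0 ≤ ε t) (hε1 : ∀ t, ε t < 1)
    (hεα : ∀ t, α * p0 / (1 - ε t) ≤ 1)
    (u : ℕ → ℝ)
    (hrec : ∀ t : ℕ, u (t + 1) =
      (1 - α * p0 / (1 - ε (t + 1))) * u t
        + (α * p0 / (1 - ε (t + 1))) * ((1 - ε (t + 1)) * μ0 + ε (t + 1) * μ1))
    (d : ℕ → ℝ) (hd : ∀ t, d t = |u t - μ1|) :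
    ∀ t : ℕ, d (t + 1) - d t ≤ α * p0 * (|μ0 - μ1| - d t / (1 - ε (t + 1))) := by
  intro t
  have h1 : (0:ℝ) < 1 - ε (t + 1) := by linarith [hε1 (t + 1)]
  have hk := hεα (t + 1)
  have hkm : α * p0 / (1 - ε (t + 1)) * (1 - ε (t + 1)) = α * p0 :=
    div_mul_cancel₀ _ h1.ne'
  have hdiv : α * p0 * (d t / (1 - ε (t + 1))) = α * p0 / (1 - ε (t + 1)) * d t := by ring
  have hr := hrec t
  rw [mul_sub, hdiv]
  generalize α * p0 / (1 - ε (t + 1)) = k at *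
  have e : u (t + 1) - μ1 = (1 - k) * (u t - μ1) + α * p0 * (μ0 - μ1) := by
    rw [hr, ← hkm]; ring
  have hb := abs_add_le ((1 - k) * (u t - μ1)) (α * p0 * (μ0 - μ1))
  rw [← e, abs_mul, abs_mul, abs_of_nonneg (sub_nonneg.2 hk),
    abs_of_pos (mul_pos hα hp0), ← hd, ← hd] at hb
  linarith
end

section
/- Let μ0, μ1 ∈ ℝ with μ0 ≠ μ1, p0 ∈ (0,1), α ∈ (0,1), and let (ε_t) be a sequence in [0,1) with 0 < α·p0/(1−ε_t) ≤ 1 for every t. Let (u_t) satisfy u_t = (1 − α·p0/(1−ε_t))·u_{t−1} + (α·p0/(1−ε_t))·((1−ε_t)·μ0 + ε_t·μ1) and set d_t = |u_t − μ1|. Fix integers T ≤ τ. If for every t with T ≤ t ≤ τ we have ε_t > 1 − d_{t−1}/|μ0 − μ1|, then d_t < d_{t−1} for every t with T ≤ t ≤ τ; that is, the distance from the expected cluster-0 mean to μ1 is strictly decreasing throughout the interval. -/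
theorem stmt_3 (μ0 μ1 p0 α : ℝ) (hμ : μ0 ≠ μ1) (hp0 : 0 < p0) (hp0' : p0 < 1)
    (hα : 0 < α) (hα' : α < 1)
    (ε : ℕ → ℝ) (hε0 : ∀ t, 0 ≤ ε t) (hε1 : ∀ t, ε t < 1)
    (hεα : ∀ t, 0 < α * p0 / (1 - ε t) ∧ α * p0 / (1 - ε t) ≤ 1)
    (u : ℕ → ℝ)
    (hrec : ∀ t : ℕ, u (t + 1) =
      (1 - α * p0 / (1 - ε (t + 1))) * u t
        + (α * p0 / (1 - ε (t + 1))) * ((1 - ε (t + 1)) * μ0 + ε (t + 1) * μ1))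
    (d : ℕ → ℝ) (hd : ∀ t, d t = |u t - μ1|)
    (T τ : ℕ) (hT1 : 1 ≤ T) (hTτ : T ≤ τ)
    (hcond : ∀ t, T ≤ t → t ≤ τ → ε t > 1 - d (t - 1) / |μ0 - μ1|) :
    ∀ t, T ≤ t → t ≤ τ → d t < d (t - 1) := by
  intro t h1 h2
  have hc := hcond t h1 h2
  obtain ⟨s, rfl⟩ : ∃ s, t = s + 1 := ⟨t - 1, by omega⟩
  rw [Nat.add_sub_cancel] at hc ⊢
  have hD : 0 < |μ0 - μ1| := abs_pos.mpr (sub_ne_zero.mpr hμ)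
  obtain ⟨hk0, hk1⟩ := hεα (s + 1)
  have hr := hrec s
  have he := hε1 (s + 1)
  generalize α * p0 / (1 - ε (s + 1)) = k at hk0 hk1 hr
  have hlt : (1 - ε (s + 1)) * |μ0 - μ1| < d s := by
    rw [← lt_div_iff₀ hD]
    linarith
  have e : u (s + 1) - μ1 = (1 - k) * (u s - μ1) + k * ((1 - ε (s + 1)) * (μ0 - μ1)) := by
    rw [hr]
    ring
  calc d (s + 1) = |(1 - k) * (u s - μ1) + k * ((1 - ε (s + 1)) * (μ0 - μ1))| := by rw [hd, e]
    _ ≤ |(1 - k) * (u s - μ1)| + |k * ((1 - ε (s + 1)) * (μ0 - μ1))| := abs_add_le _ _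
    _ = (1 - k) * d s + k * ((1 - ε (s + 1)) * |μ0 - μ1|) := by
      rw [abs_mul, abs_mul, abs_mul, abs_of_nonneg (sub_nonneg.mpr hk1), abs_of_pos hk0,
        abs_of_pos (sub_pos.mpr he), hd]
    _ < d s := by
      have := mul_lt_mul_of_pos_left hlt hk0
      linarith
end
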